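/- arXiv:2501.13712 — 3 statements merged into one kernel-verified Lean document; each statement's English description precedes it below -/
import Mathlib

section
/- For every LTL_f formula ρ, every trace T of length d, and every time index t, the loss at smoothing factor zero vanishes exactly on satisfying traces: L(ρ,T,t,0) = 0 if and only if eval(ρ,T,t) = True. -/
/-- LTL_f formulas over real-valued traces. Atoms compare state components
indexed by natural numbers. -/
inductive Formula : Type where
  | leq : ℕ → ℕ → Formula          -- φ₁ ≤ φ₂
  | lt : ℕ → ℕ → Formula           -- φ₁ < φ₂
  | eq : ℕ → ℕ → Formula           -- φ₁ = φ₂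
  | neq : ℕ → ℕ → Formula          -- φ₁ ≠ φ₂
  | conj : Formula → Formula → Formula
  | disj : Formula → Formula → Formula
  | snext : Formula → Formula      -- 𝒩 (Strong Next)
  | wnext : Formula → Formula      -- 𝒳 (Weak Next)
  | always : Formula → Formula     -- □
  | eventually : Formula → Formula -- ◇
  | wuntil : Formula → Formula → Formula   -- 𝒰 (Weak Until)
  | srelease : Formula → Formula → Formula -- ℛ (Strong Release)

/-- Boolean evaluation of an LTL_f formula over a trace of length `d`
(states `T 0, …, T (d-1)`, each a function ℕ → ℝ), from time `t`. -/
noncomputable def eval (d : ℕ) (T : ℕ → ℕ → ℝ) : Formula → ℕ → Bool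
  | ρ, t =>
    if t ≥ d then false
    else
      match ρ with
      | .leq a b => decide (T t a ≤ T t b)
      | .lt a b => decide (T t a < T t b)
      | .eq a b => decide (T t a = T t b)
      | .neq a b => decide (T t a ≠ T t b)
      | .conj ρ₁ ρ₂ => eval d T ρ₁ t && eval d T ρ₂ t
      | .disj ρ₁ ρ₂ => eval d T ρ₁ t || eval d T ρ₂ t
      | .snext ρ' => eval d T ρ' (t+1)
      | .wnext ρ' => if t = d - 1 then true else eval d T ρ' (t+1)
      | .always ρ' =>
          eval d T ρ' t && (if t = d - 1 then true else eval d T (.always ρ') (t+1))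
      | .eventually ρ' => eval d T ρ' t || eval d T (.eventually ρ') (t+1)
      | .wuntil ρ₁ ρ₂ =>
          eval d T ρ₂ t || (eval d T ρ₁ t &&
            (if t = d - 1 then true else eval d T (.wuntil ρ₁ ρ₂) (t+1)))
      | .srelease ρ₁ ρ₂ =>
          (eval d T ρ₁ t && eval d T ρ₂ t) ||
            (eval d T ρ₂ t && eval d T (.srelease ρ₁ ρ₂) (t+1))
termination_by ρ t => (d - t, sizeOf ρ)

/-- Smooth maximum: `max γ a b`. -/
noncomputable def smax (γ a b : ℝ) : ℝ :=
  if γ ≤ 0 then max a b else γ * Real.log (Real.exp (a / γ) + Real.exp (b / γ))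

/-- Smooth minimum: `min γ a b`. -/
noncomputable def smin (γ a b : ℝ) : ℝ :=
  if γ ≤ 0 then min a b else -γ * Real.log (Real.exp (-a / γ) + Real.exp (-b / γ))

/-- Smooth Gaussian: `Gaussian γ a`. -/
noncomputable def sgauss (γ a : ℝ) : ℝ :=
  if γ ≤ 0 then (if a = 0 then 1 else 0) else Real.exp (-(a ^ 2) / (2 * γ ^ 2))

/-- A weight on formulas, used as a termination measure for the recursion
defining the loss (the clauses for `<` and `=` recurse into the clauses
for `≤` and `≠` at the same time step). -/
def Formula.weight : Formula → ℕ
  | .leq _ _ => 1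
  | .neq _ _ => 1
  | .lt _ _ => 2
  | .eq _ _ => 2
  | .conj ρ₁ ρ₂ => ρ₁.weight + ρ₂.weight + 1
  | .disj ρ₁ ρ₂ => ρ₁.weight + ρ₂.weight + 1
  | .snext ρ => ρ.weight + 1
  | .wnext ρ => ρ.weight + 1
  | .always ρ => ρ.weight + 1
  | .eventually ρ => ρ.weight + 1
  | .wuntil ρ₁ ρ₂ => ρ₁.weight + ρ₂.weight + 1
  | .srelease ρ₁ ρ₂ => ρ₁.weight + ρ₂.weight + 1


/-- The loss function L(ρ,T,t,γ) over a trace of length `d`. -/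
noncomputable def L (d : ℕ) (T : ℕ → ℕ → ℝ) (γ : ℝ) : Formula → ℕ → ℝ
  | ρ, t =>
    if t ≥ d then 1
    else
      match ρ with
      | .leq a b => smax γ (T t a - T t b) 0
      | .neq a b => sgauss γ (T t a - T t b)
      | .lt a b => smax γ (L d T γ (.leq a b) t) (L d T γ (.neq a b) t)
      | .eq a b => smax γ (L d T γ (.leq a b) t) (L d T γ (.leq b a) t)
      | .conj ρ₁ ρ₂ => smax γ (L d T γ ρ₁ t) (L d T γ ρ₂ t)
      | .disj ρ₁ ρ₂ => smin γ (L d T γ ρ₁ t) (L d T γ ρ₂ t)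
      | .snext ρ' => L d T γ ρ' (t+1)
      | .wnext ρ' => if t = d - 1 then 0 else L d T γ ρ' (t+1)
      | .always ρ' =>
          smax γ (L d T γ ρ' t)
            (if t = d - 1 then 0 else L d T γ (.always ρ') (t+1))
      | .eventually ρ' => smin γ (L d T γ ρ' t) (L d T γ (.eventually ρ') (t+1))
      | .wuntil ρ₁ ρ₂ =>
          smin γ (L d T γ ρ₂ t)
            (smax γ (L d T γ ρ₁ t)
              (if t = d - 1 then 0 else L d T γ (.wuntil ρ₁ ρ₂) (t+1)))
      | .srelease ρ₁ ρ₂ =>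
          smin γ (smax γ (L d T γ ρ₁ t) (L d T γ ρ₂ t))
            (smax γ (L d T γ ρ₂ t) (L d T γ (.srelease ρ₁ ρ₂) (t+1)))
termination_by ρ t => (d - t, ρ.weight)
decreasing_by all_goals
  (first
    | exact Prod.Lex.left _ _ (by omega)
    | exact Prod.Lex.right _ (by simp [Formula.weight] <;> omega))

/-- A real loss `x` is nonnegative and vanishes exactly when the truth value `b` is true. -/
def LossMatches (x : ℝ) (b : Bool) : Prop :=
  0 ≤ x ∧ (x = 0 ↔ b = true)

namespace LossMatches

theorem one_false : LossMatches 1 false := by simp [LossMatches]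

theorem zero_true : LossMatches 0 true := by simp [LossMatches]

theorem smax_zero {x y : ℝ} {a b : Bool} (hx : LossMatches x a) (hy : LossMatches y b) :
    LossMatches (smax 0 x y) (a && b) := by
  obtain ⟨hx0, hx⟩ := hx
  obtain ⟨hy0, hy⟩ := hy
  rw [smax, if_pos le_rfl]
  refine ⟨le_max_of_le_left hx0, ?_⟩
  rw [Bool.and_eq_true, ← hx, ← hy]
  constructor
  · intro h
    exact ⟨le_antisymm (h ▸ le_max_left x y) hx0, le_antisymm (h ▸ le_max_right x y) hy0⟩
  · rintro ⟨rfl, rfl⟩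
    exact max_self 0

theorem smin_zero {x y : ℝ} {a b : Bool} (hx : LossMatches x a) (hy : LossMatches y b) :
    LossMatches (smin 0 x y) (a || b) := by
  obtain ⟨hx0, hx⟩ := hx
  obtain ⟨hy0, hy⟩ := hy
  rw [smin, if_pos le_rfl]
  refine ⟨le_min hx0 hy0, ?_⟩
  rw [Bool.or_eq_true, ← hx, ← hy]
  constructor
  · intro h
    rcases min_choice x y with h' | h'
    · exact Or.inl (h' ▸ h)
    · exact Or.inr (h' ▸ h)
  · rintro (rfl | rfl)
    · exact min_eq_left hy0
    · exact min_eq_right hx0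

theorem ite {p : Prop} [Decidable p] {x y : ℝ} {a b : Bool}
    (hx : LossMatches x a) (hy : LossMatches y b) :
    LossMatches (if p then x else y) (if p then a else b) := by
  split_ifs <;> assumption

theorem smax_sub_zero (x y : ℝ) : LossMatches (smax 0 (x - y) 0) (decide (x ≤ y)) := by
  simp [LossMatches, smax]

theorem sgauss_sub_zero (x y : ℝ) : LossMatches (sgauss 0 (x - y)) (decide (x ≠ y)) := by
  by_cases h : x = y <;> simp [LossMatches, sgauss, sub_eq_zero, h]

end LossMatches

theorem lossMatches_eval_of_le {d t : ℕ} (T : ℕ → ℕ → ℝ) (ρ : Formula) (h : d ≤ t) :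
    LossMatches (L d T 0 ρ t) (eval d T ρ t) := by
  rw [L.eq_def, eval.eq_def]
  dsimp only
  rw [if_pos h, if_pos h]
  exact .one_false

theorem lossMatches_eval_of_succ {d t : ℕ} (T : ℕ → ℕ → ℝ) (h : t < d)
    (next : ∀ ρ, LossMatches (L d T 0 ρ (t + 1)) (eval d T ρ (t + 1))) (ρ : Formula) :
    LossMatches (L d T 0 ρ t) (eval d T ρ t) := by
  have h' : ¬ t ≥ d := Nat.not_le.mpr h
  have leq (a b : ℕ) : LossMatches (L d T 0 (.leq a b) t) (decide (T t a ≤ T t b)) := by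
    rw [L, if_neg h']
    exact .smax_sub_zero _ _
  have neq (a b : ℕ) : LossMatches (L d T 0 (.neq a b) t) (decide (T t a ≠ T t b)) := by
    rw [L, if_neg h']
    exact .sgauss_sub_zero _ _
  induction ρ with
  | leq a b =>
    rw [eval, if_neg h']
    exact leq a b
  | neq a b =>
    rw [eval, if_neg h']
    exact neq a b
  | lt a b =>
    rw [L, eval, if_neg h', if_neg h']
    simpa only [lt_iff_le_and_ne, Bool.decide_and] using (leq a b).smax_zero (neq a b)
  | eq a b =>
    rw [L, eval, if_neg h', if_neg h']
    simpa only [le_antisymm_iff, Bool.decide_and] using (leq a b).smax_zero (leq b a)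
  | conj ρ₁ ρ₂ ih₁ ih₂ =>
    rw [L, eval, if_neg h', if_neg h']
    exact ih₁.smax_zero ih₂
  | disj ρ₁ ρ₂ ih₁ ih₂ =>
    rw [L, eval, if_neg h', if_neg h']
    exact ih₁.smin_zero ih₂
  | snext ρ ih =>
    rw [L, eval, if_neg h', if_neg h']
    exact next ρ
  | wnext ρ ih =>
    rw [L, eval, if_neg h', if_neg h']
    exact .ite .zero_true (next ρ)
  | always ρ ih =>
    rw [L, eval, if_neg h', if_neg h']
    exact ih.smax_zero (.ite .zero_true (next _))
  | eventually ρ ih =>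
    rw [L, eval, if_neg h', if_neg h']
    exact ih.smin_zero (next _)
  | wuntil ρ₁ ρ₂ ih₁ ih₂ =>
    rw [L, eval, if_neg h', if_neg h']
    exact ih₂.smin_zero (ih₁.smax_zero (.ite .zero_true (next _)))
  | srelease ρ₁ ρ₂ ih₁ ih₂ =>
    rw [L, eval, if_neg h', if_neg h']
    exact (ih₁.smax_zero ih₂).smin_zero (ih₂.smax_zero (next _))

theorem lossMatches_eval (d : ℕ) (T : ℕ → ℕ → ℝ) (ρ : Formula) (t : ℕ) :
    LossMatches (L d T 0 ρ t) (eval d T ρ t) := by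
  rcases le_total d t with h | h
  · exact lossMatches_eval_of_le T ρ h
  · induction h using Nat.decreasingInduction generalizing ρ with
    | self => exact lossMatches_eval_of_le T ρ le_rfl
    | of_succ t ht ih => exact lossMatches_eval_of_succ T ht ih ρ

/-- the loss at smoothing factor zero vanishes exactly on
satisfying traces. -/
theorem loss_zero_iff_eval (ρ : Formula) (d : ℕ) (T : ℕ → ℕ → ℝ) (t : ℕ) :
    L d T 0 ρ t = 0 ↔ eval d T ρ t = true :=
  (lossMatches_eval d T ρ t).2
end

section
/- (Soundness of the loss function.) For every LTL_f formula ρ, every trace T of length d, and every time index t: L(ρ,T,t,γ) tends to 0 as γ tends to 0 from the right if and only if eval(ρ,T,t) = True. -/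
open Filter Topology

theorem max_le_smax {γ : ℝ} (hγ : 0 < γ) (a b : ℝ) : max a b ≤ smax γ a b := by
  have bound (c : ℝ) (hc : Real.exp (c / γ) ≤ Real.exp (a / γ) + Real.exp (b / γ)) :
      c ≤ γ * Real.log (Real.exp (a / γ) + Real.exp (b / γ)) := by
    have h := Real.log_le_log (Real.exp_pos _) hc
    rw [Real.log_exp, div_le_iff₀ hγ] at h
    linarith
  rw [smax, if_neg (not_le.mpr hγ)]
  exact max_le (bound a (by linarith [Real.exp_pos (b / γ)]))
    (bound b (by linarith [Real.exp_pos (a / γ)]))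

theorem smax_le_max_add {γ : ℝ} (hγ : 0 < γ) (a b : ℝ) :
    smax γ a b ≤ max a b + γ * Real.log 2 := by
  rw [smax, if_neg (not_le.mpr hγ)]
  have ha : Real.exp (a / γ) ≤ Real.exp (max a b / γ) := by
    gcongr
    exact le_max_left a b
  have hb : Real.exp (b / γ) ≤ Real.exp (max a b / γ) := by
    gcongr
    exact le_max_right a b
  have h : Real.log (Real.exp (a / γ) + Real.exp (b / γ)) ≤ Real.log 2 + max a b / γ := by
    rw [← Real.log_exp (max a b / γ), ← Real.log_mul two_ne_zero (Real.exp_ne_zero _)]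
    exact Real.log_le_log (by positivity) (by linarith)
  calc γ * Real.log (Real.exp (a / γ) + Real.exp (b / γ))
      ≤ γ * (Real.log 2 + max a b / γ) := by gcongr
    _ = max a b + γ * Real.log 2 := by field_simp; ring

theorem smin_eq_neg_smax_neg (γ a b : ℝ) : smin γ a b = -smax γ (-a) (-b) := by
  unfold smin smax
  split_ifs
  · rw [max_neg_neg, neg_neg]
  · ring

theorem tendsto_smax {f g : ℝ → ℝ} {a b : ℝ} (hf : Tendsto f (𝓝[>] 0) (𝓝 a))
    (hg : Tendsto g (𝓝[>] 0) (𝓝 b)) :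
    Tendsto (fun γ => smax γ (f γ) (g γ)) (𝓝[>] 0) (𝓝 (max a b)) := by
  have hid : Tendsto (fun γ : ℝ => γ * Real.log 2) (𝓝[>] 0) (𝓝 0) := by
    have h : Tendsto (fun γ : ℝ => γ * Real.log 2) (𝓝 0) (𝓝 (0 * Real.log 2)) :=
      tendsto_id.mul_const _
    rw [zero_mul] at h
    exact h.mono_left nhdsWithin_le_nhds
  have hupper := (hf.max hg).add hid
  rw [add_zero] at hupper
  refine tendsto_of_tendsto_of_tendsto_of_le_of_le' (hf.max hg) hupper ?_ ?_
  · filter_upwards [self_mem_nhdsWithin] with γ hγ using max_le_smax hγ _ _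
  · filter_upwards [self_mem_nhdsWithin] with γ hγ using smax_le_max_add hγ _ _

theorem tendsto_smin {f g : ℝ → ℝ} {a b : ℝ} (hf : Tendsto f (𝓝[>] 0) (𝓝 a))
    (hg : Tendsto g (𝓝[>] 0) (𝓝 b)) :
    Tendsto (fun γ => smin γ (f γ) (g γ)) (𝓝[>] 0) (𝓝 (min a b)) := by
  have h := (tendsto_smax hf.neg hg.neg).neg
  rw [max_neg_neg, neg_neg] at h
  simpa only [smin_eq_neg_smax_neg] using h

theorem tendsto_sgauss (a : ℝ) :
    Tendsto (fun γ => sgauss γ a) (𝓝[>] 0) (𝓝 (if a = 0 then 1 else 0)) := by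
  have heq : (fun γ => Real.exp (-(a ^ 2) / (2 * γ ^ 2))) =ᶠ[𝓝[>] 0] fun γ => sgauss γ a := by
    filter_upwards [self_mem_nhdsWithin] with γ hγ
    rw [sgauss, if_neg (not_le.mpr hγ)]
  refine Tendsto.congr' heq ?_
  split_ifs with ha
  · simp [ha]
  · refine Real.tendsto_exp_atBot.comp ?_
    have hinv : Tendsto (fun γ : ℝ => (γ⁻¹) ^ 2) (𝓝[>] 0) atTop :=
      (tendsto_pow_atTop two_ne_zero).comp tendsto_inv_nhdsGT_zero
    have hneg : -(a ^ 2) / 2 < 0 := by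
      have : 0 < a ^ 2 := by positivity
      linarith
    refine (hinv.const_mul_atTop_of_neg hneg).congr fun γ => ?_
    rw [inv_pow, div_mul_eq_div_div, div_eq_mul_inv (-(a ^ 2) / 2)]

/-- `f` has a nonnegative limit at `0⁺`, which vanishes exactly when `p` holds. -/
def LimitDetects (f : ℝ → ℝ) (p : Prop) : Prop :=
  ∃ l : ℝ, 0 ≤ l ∧ Tendsto f (𝓝[>] 0) (𝓝 l) ∧ (l = 0 ↔ p)

namespace LimitDetects

variable {f g : ℝ → ℝ} {p q : Prop}

theorem tendsto_zero_iff (h : LimitDetects f p) : Tendsto f (𝓝[>] 0) (𝓝 0) ↔ p := by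
  obtain ⟨l, -, hl, hp⟩ := h
  rw [← hp]
  exact ⟨fun h0 => tendsto_nhds_unique hl h0, fun h0 => h0 ▸ hl⟩

theorem zero : LimitDetects (fun _ => 0) True :=
  ⟨0, le_rfl, tendsto_const_nhds, by simp⟩

theorem one : LimitDetects (fun _ => 1) False :=
  ⟨1, zero_le_one, tendsto_const_nhds, by simp⟩

theorem smax (hf : LimitDetects f p) (hg : LimitDetects g q) :
    LimitDetects (fun γ => smax γ (f γ) (g γ)) (p ∧ q) := by
  obtain ⟨a, ha, hfa, hp⟩ := hf
  obtain ⟨b, hb, hgb, hq⟩ := hg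
  refine ⟨max a b, le_max_of_le_left ha, tendsto_smax hfa hgb, ?_⟩
  rw [← hp, ← hq]
  grind

theorem smin (hf : LimitDetects f p) (hg : LimitDetects g q) :
    LimitDetects (fun γ => smin γ (f γ) (g γ)) (p ∨ q) := by
  obtain ⟨a, ha, hfa, hp⟩ := hf
  obtain ⟨b, hb, hgb, hq⟩ := hg
  refine ⟨min a b, le_min ha hb, tendsto_smin hfa hgb, ?_⟩
  rw [← hp, ← hq]
  grind

theorem ite_zero {c : Prop} [Decidable c] (hf : LimitDetects f p) :
    LimitDetects (fun γ => if c then 0 else f γ) (c ∨ p) := by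
  by_cases hc : c
  · simpa [hc] using zero
  · simpa [hc] using hf

theorem smax_sub (x y : ℝ) : LimitDetects (fun γ => _root_.smax γ (x - y) 0) (x ≤ y) :=
  ⟨max (x - y) 0, le_max_right _ _, tendsto_smax tendsto_const_nhds tendsto_const_nhds, by simp⟩

theorem sgauss_sub (x y : ℝ) : LimitDetects (fun γ => sgauss γ (x - y)) (x ≠ y) :=
  ⟨_, by split_ifs <;> simp, tendsto_sgauss (x - y), by simp [sub_eq_zero]⟩

end LimitDetects

theorem L_of_le {d t : ℕ} (h : d ≤ t) (T : ℕ → ℕ → ℝ) (γ : ℝ) (ρ : Formula) :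
    L d T γ ρ t = 1 := by
  rw [L.eq_def]
  exact if_pos h

theorem eval_of_le {d t : ℕ} (h : d ≤ t) (T : ℕ → ℕ → ℝ) (ρ : Formula) :
    eval d T ρ t = false := by
  rw [eval.eq_def]
  exact if_pos h

theorem limitDetects_L_eval (ρ : Formula) (d : ℕ) (T : ℕ → ℕ → ℝ) (t : ℕ) :
    LimitDetects (fun γ => L d T γ ρ t) (eval d T ρ t = true) := by
  have past (ρ : Formula) (t : ℕ) (h : d ≤ t) :
      LimitDetects (fun γ => L d T γ ρ t) (eval d T ρ t = true) := by
    simpa [L_of_le h, eval_of_le h] using LimitDetects.one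
  have backward (ρ : Formula) (step : ∀ t < d,
      LimitDetects (fun γ => L d T γ ρ (t + 1)) (eval d T ρ (t + 1) = true) →
        LimitDetects (fun γ => L d T γ ρ t) (eval d T ρ t = true)) (t : ℕ) :
      LimitDetects (fun γ => L d T γ ρ t) (eval d T ρ t = true) := by
    rcases le_total d t with h | h
    · exact past ρ t h
    · induction h using Nat.decreasingInduction with
      | self => exact past ρ d le_rfl
      | of_succ t ht ih => exact step t ht ih
  induction ρ generalizing t with
  | leq a b =>
    refine backward _ (fun t ht _ => ?_) t
    simpa [L, eval, not_le.mpr ht] using LimitDetects.smax_sub (T t a) (T t b)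
  | neq a b =>
    refine backward _ (fun t ht _ => ?_) t
    simpa [L, eval, not_le.mpr ht] using LimitDetects.sgauss_sub (T t a) (T t b)
  | lt a b =>
    refine backward _ (fun t ht _ => ?_) t
    simpa [L, eval, not_le.mpr ht, lt_iff_le_and_ne] using
      (LimitDetects.smax_sub (T t a) (T t b)).smax (LimitDetects.sgauss_sub (T t a) (T t b))
  | eq a b =>
    refine backward _ (fun t ht _ => ?_) t
    simpa [L, eval, not_le.mpr ht, le_antisymm_iff (α := ℝ)] using
      (LimitDetects.smax_sub (T t a) (T t b)).smax (LimitDetects.smax_sub (T t b) (T t a))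
  | conj ρ₁ ρ₂ ih₁ ih₂ =>
    refine backward _ (fun t ht _ => ?_) t
    rw [eval]
    simp only [L.eq_def d T _ (.conj ρ₁ ρ₂) t]
    simpa [not_le.mpr ht] using (ih₁ t).smax (ih₂ t)
  | disj ρ₁ ρ₂ ih₁ ih₂ =>
    refine backward _ (fun t ht _ => ?_) t
    rw [eval]
    simp only [L.eq_def d T _ (.disj ρ₁ ρ₂) t]
    simpa [not_le.mpr ht] using (ih₁ t).smin (ih₂ t)
  | snext ρ ih =>
    refine backward _ (fun t ht _ => ?_) t
    rw [eval]
    simp only [L.eq_def d T _ (.snext ρ) t]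
    simpa [not_le.mpr ht] using ih (t + 1)
  | wnext ρ ih =>
    refine backward _ (fun t ht _ => ?_) t
    rw [eval]
    simp only [L.eq_def d T _ (.wnext ρ) t]
    simpa [not_le.mpr ht] using (ih (t + 1)).ite_zero (c := t = d - 1)
  | always ρ ih =>
    refine backward _ (fun t ht next => ?_) t
    rw [eval]
    simp only [L.eq_def d T _ (.always ρ) t]
    simpa [not_le.mpr ht] using (ih t).smax (next.ite_zero (c := t = d - 1))
  | eventually ρ ih =>
    refine backward _ (fun t ht next => ?_) t
    rw [eval]
    simp only [L.eq_def d T _ (.eventually ρ) t]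
    simpa [not_le.mpr ht] using (ih t).smin next
  | wuntil ρ₁ ρ₂ ih₁ ih₂ =>
    refine backward _ (fun t ht next => ?_) t
    rw [eval]
    simp only [L.eq_def d T _ (.wuntil ρ₁ ρ₂) t]
    simpa [not_le.mpr ht] using
      (ih₂ t).smin ((ih₁ t).smax (next.ite_zero (c := t = d - 1)))
  | srelease ρ₁ ρ₂ ih₁ ih₂ =>
    refine backward _ (fun t ht next => ?_) t
    rw [eval]
    simp only [L.eq_def d T _ (.srelease ρ₁ ρ₂) t]
    simpa [not_le.mpr ht] using ((ih₁ t).smax (ih₂ t)).smin ((ih₂ t).smax next)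

/-- Soundness of the loss function: L(ρ,T,t,γ) → 0 as γ → 0⁺
iff eval(ρ,T,t) = True. -/
theorem loss_soundness (ρ : Formula) (d : ℕ) (T : ℕ → ℕ → ℝ) (t : ℕ) :
    Tendsto (fun γ : ℝ => L d T γ ρ t) (𝓝[>] 0) (𝓝 0) ↔
      eval d T ρ t = true :=
  (limitDetects_L_eval ρ d T t).tendsto_zero_iff
end

section
/- (Idempotence of the loss in the limit.) For every LTL_f formula ρ, every trace T, and every time index t: the difference L(ρ ∧ ρ, T, t, γ) − L(ρ, T, t, γ) tends to 0 as γ tends to 0, and likewise L(ρ ∨ ρ, T, t, γ) − L(ρ, T, t, γ) tends to 0 as γ tends to 0. -/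
open Filter Topology

theorem smax_self (γ a : ℝ) : smax γ a a = a + max γ 0 * Real.log 2 := by
  rcases le_or_gt γ 0 with h | h
  · simp [smax, h]
  · rw [smax, if_neg h.not_ge, max_eq_left h.le, ← two_mul,
      Real.log_mul two_ne_zero (Real.exp_ne_zero _), Real.log_exp]
    field_simp
    ring

theorem smin_self (γ a : ℝ) : smin γ a a = a - max γ 0 * Real.log 2 := by
  rcases le_or_gt γ 0 with h | h
  · simp [smin, h]
  · rw [smin, if_neg h.not_ge, max_eq_left h.le, ← two_mul,
      Real.log_mul two_ne_zero (Real.exp_ne_zero _), Real.log_exp]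
    field_simp
    ring

theorem L_conj_of_lt {d t : ℕ} (h : t < d) (T : ℕ → ℕ → ℝ) (γ : ℝ) (ρ₁ ρ₂ : Formula) :
    L d T γ (ρ₁.conj ρ₂) t = smax γ (L d T γ ρ₁ t) (L d T γ ρ₂ t) := by
  rw [L.eq_def]
  exact if_neg h.not_ge

theorem L_disj_of_lt {d t : ℕ} (h : t < d) (T : ℕ → ℕ → ℝ) (γ : ℝ) (ρ₁ ρ₂ : Formula) :
    L d T γ (ρ₁.disj ρ₂) t = smin γ (L d T γ ρ₁ t) (L d T γ ρ₂ t) := by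
  rw [L.eq_def]
  exact if_neg h.not_ge

theorem tendsto_max_zero_mul_log_two :
    Tendsto (fun γ : ℝ => max γ 0 * Real.log 2) (𝓝 0) (𝓝 0) := by
  have h : Continuous fun γ : ℝ => max γ 0 * Real.log 2 := by fun_prop
  simpa using h.tendsto 0

/-- Idempotence of the loss in the limit γ → 0. -/
theorem loss_idem_limit (ρ : Formula) (d : ℕ) (T : ℕ → ℕ → ℝ) (t : ℕ) :
    Tendsto (fun γ : ℝ => L d T γ (ρ.conj ρ) t - L d T γ ρ t) (𝓝 0) (𝓝 0) ∧
      Tendsto (fun γ : ℝ => L d T γ (ρ.disj ρ) t - L d T γ ρ t) (𝓝 0)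
        (𝓝 0) := by
  rcases le_or_gt d t with h | h
  · simp [L_of_le h]
  · simp only [L_conj_of_lt h, L_disj_of_lt h, smax_self, smin_self, add_sub_cancel_left,
      sub_sub_cancel_left]
    exact ⟨tendsto_max_zero_mul_log_two, by simpa using tendsto_max_zero_mul_log_two.neg⟩
end
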